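/- For every n ≥ 1 there exist unique functions μ_0, μ_1, ..., μ_n (the intrinsic volumes) from the set of nonempty compact convex subsets of ℝⁿ to ℝ such that for every nonempty compact convex K ⊆ ℝⁿ and every t ≥ 0 one has vol_n(K + tB) = Σ_{k=0}^{n} μ_{n-k}(K) ω_k t^k (Steiner formula), where K + tB denotes the Minkowski sum of K with the rescaled closed unit ball. Moreover each μ_k is a continuous, translation invariant valuation, is invariant under every rotation g ∈ SO(n), is homogeneous of degree k (μ_k(tK) = t^k μ_k(K) for all t ≥ 0), and is even (μ_k(-K) = μ_k(K)). -/

import Mathlib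

open MeasureTheory Metric Set
open scoped Pointwise ENNReal

noncomputable section

/-- Euclidean `n`-space. -/
abbrev En (n : ℕ) := EuclideanSpace ℝ (Fin n)

instance matrixMeasurableSpace (n : ℕ) : MeasurableSpace (Matrix (Fin n) (Fin n) ℝ) :=
  inferInstanceAs (MeasurableSpace ((Fin n) → (Fin n) → ℝ))

/-- The special orthogonal group `SO(n)`, as the subgroup of the (real) unitary group
consisting of matrices of determinant one. -/
def SO (n : ℕ) : Subgroup (Matrix.unitaryGroup (Fin n) ℝ) where
  carrier := {g | Matrix.det (g : Matrix (Fin n) (Fin n) ℝ) = 1}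
  one_mem' := by simp
  mul_mem' := by
    intro a b ha hb
    simp only [Set.mem_setOf_eq] at *
    rw [MulMemClass.coe_mul, Matrix.det_mul, ha, hb, mul_one]
  inv_mem' := by
    intro a ha
    simp only [Set.mem_setOf_eq] at *
    have h : ((a⁻¹ * a : Matrix.unitaryGroup (Fin n) ℝ) : Matrix (Fin n) (Fin n) ℝ) = 1 := by
      rw [inv_mul_cancel]; rfl
    have h2 := congrArg Matrix.det h
    rw [MulMemClass.coe_mul, Matrix.det_mul, ha, mul_one, Matrix.det_one] at h2
    exact h2

/-- The linear action of an element of `SO(n)` on `ℝⁿ`. -/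
def soAct {n : ℕ} (g : SO n) : En n →ₗ[ℝ] En n :=
  Matrix.toEuclideanLin ((g : Matrix.unitaryGroup (Fin n) ℝ) : Matrix (Fin n) (Fin n) ℝ)

variable {V : Type*} [NormedAddCommGroup V] [NormedSpace ℝ V]

/-- `μ` is a valuation: additivity on unions of convex bodies whose union is again convex. -/
def IsValuation (μ : ConvexBody V → ℝ) : Prop :=
  ∀ K L M N : ConvexBody V,
    (M : Set V) = (K : Set V) ∪ (L : Set V) → (N : Set V) = (K : Set V) ∩ (L : Set V) →
      μ M + μ N = μ K + μ L

/-- `μ` is translation invariant. -/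
def IsTranslationInvariant (μ : ConvexBody V → ℝ) : Prop :=
  ∀ (x : V) (K L : ConvexBody V), (L : Set V) = x +ᵥ (K : Set V) → μ L = μ K

/-- `μ` is homogeneous of degree `k`. -/
def IsHomogeneousVal (k : ℕ) (μ : ConvexBody V → ℝ) : Prop :=
  ∀ (t : ℝ), 0 ≤ t → ∀ K L : ConvexBody V,
    (L : Set V) = t • (K : Set V) → μ L = t ^ k * μ K

/-- `μ` is an even valuation. -/
def IsEvenVal (μ : ConvexBody V → ℝ) : Prop :=
  ∀ K L : ConvexBody V, (L : Set V) = -(K : Set V) → μ L = μ K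

/-- `μ` is invariant under the action of `SO(n)`. -/
def IsSOInvariant (n : ℕ) (μ : ConvexBody (En n) → ℝ) : Prop :=
  ∀ (g : SO n) (K L : ConvexBody (En n)),
    (L : Set (En n)) = (soAct g) '' (K : Set (En n)) → μ L = μ K

/-- `ω k`, the volume of the `k`-dimensional Euclidean unit ball. -/
def ballVol (k : ℕ) : ℝ := (volume (Metric.closedBall (0 : EuclideanSpace ℝ (Fin k)) 1)).toReal

/-- A family `μ_0, …, μ_n` satisfies the Steiner formula
`vol_n(K + tB) = ∑_{k=0}^n μ_{n-k}(K) ω_k t^k`. -/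
def SteinerFamily (n : ℕ) (μ : Fin (n+1) → ConvexBody (En n) → ℝ) : Prop :=
  ∀ (K : ConvexBody (En n)) (t : ℝ), 0 ≤ t →
    (volume ((K : Set (En n)) + t • Metric.closedBall (0 : En n) 1)).toReal
      = ∑ k : Fin (n+1), μ k.rev K * ballVol (k : ℕ) * t ^ (k : ℕ)

/-! ### Coefficient extraction via the Vandermonde matrix -/

/-- The Vandermonde matrix with nodes `1, …, n+1`. -/
def vdm (n : ℕ) : Matrix (Fin (n+1)) (Fin (n+1)) ℝ :=
  Matrix.vandermonde (fun i : Fin (n+1) => ((i : ℕ) : ℝ) + 1)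

lemma vdm_isUnit (n : ℕ) : IsUnit (vdm n).det := by
  rw [isUnit_iff_ne_zero, vdm, Matrix.det_vandermonde_ne_zero_iff]
  intro i j h
  simp only [add_left_inj, Nat.cast_inj] at h
  exact Fin.ext h

lemma coeff_extract (n : ℕ) (c : Fin (n+1) → ℝ) (k : Fin (n+1)) :
    c k = ∑ i : Fin (n+1), (vdm n)⁻¹ k i * ∑ j : Fin (n+1), c j * (((i : ℕ) : ℝ) + 1) ^ (j : ℕ) := by
  have h : (vdm n)⁻¹.mulVec ((vdm n).mulVec c) = c := by
    rw [Matrix.mulVec_mulVec, Matrix.nonsing_inv_mul _ (vdm_isUnit n), Matrix.one_mulVec]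
  conv_lhs => rw [← h]
  simp only [Matrix.mulVec, dotProduct, vdm, Matrix.vandermonde_apply]
  simp only [mul_comm (c _)]

lemma coeff_unique (n : ℕ) (c d : Fin (n+1) → ℝ)
    (h : ∀ t : ℝ, 0 < t → ∑ j : Fin (n+1), c j * t ^ (j : ℕ) = ∑ j : Fin (n+1), d j * t ^ (j : ℕ)) :
    c = d := by
  ext k
  rw [coeff_extract n c k, coeff_extract n d k]
  refine Finset.sum_congr rfl fun i _ => ?_
  rw [h _ (by positivity)]

/-- a pointwise limit of polynomials of degree at most `n` is one. -/
lemma poly_limit (n : ℕ) (c : ℕ → Fin (n+1) → ℝ) (g : ℝ → ℝ)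
    (h : ∀ t : ℝ, 0 ≤ t → Filter.Tendsto (fun m => ∑ j : Fin (n+1), c m j * t ^ (j : ℕ))
      Filter.atTop (nhds (g t))) :
    ∃ d : Fin (n+1) → ℝ, ∀ t : ℝ, 0 ≤ t → g t = ∑ j : Fin (n+1), d j * t ^ (j : ℕ) := by
  refine ⟨fun k => ∑ i : Fin (n+1), (vdm n)⁻¹ k i * g (((i : ℕ) : ℝ) + 1), fun t ht => ?_⟩
  refine tendsto_nhds_unique (h t ht) ?_
  refine tendsto_finsetSum _ fun j _ => Filter.Tendsto.mul_const _ ?_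
  simp_rw [fun m => coeff_extract n (c m) j]
  exact tendsto_finsetSum _ fun i _ => Filter.Tendsto.const_mul _ (h _ (by positivity))

lemma natDegree_le_of_bound (p : Polynomial ℝ) (n : ℕ) (C : ℝ)
    (h : ∀ t : ℝ, 1 ≤ t → |p.eval t| ≤ C * t ^ n) : p.natDegree ≤ n := by
  by_contra! hlt
  have hd : (Polynomial.X ^ n : Polynomial ℝ).degree < p.degree := by
    rw [Polynomial.degree_X_pow]
    exact Polynomial.natDegree_lt_natDegree_iff (p := Polynomial.X ^ n) (q := p) (by simp) |>.1
      (by simpa using hlt) |> fun h => by simpa using h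
  have := Polynomial.abs_div_tendsto_atTop_atTop_of_degree_gt p (Polynomial.X ^ n) hd (by simp)
  obtain ⟨t, ht, ht1⟩ := ((this.eventually_gt_atTop C).and (Filter.eventually_ge_atTop 1)).exists
  have hp : (0:ℝ) < t ^ n := by positivity
  simp only [Polynomial.eval_pow, Polynomial.eval_X, abs_div, abs_of_pos hp] at ht
  rw [lt_div_iff₀ hp] at ht
  exact absurd (h t ht1) (not_le.2 ht)

lemma poly_coeffs (p : Polynomial ℝ) (n : ℕ) (C : ℝ)
    (h : ∀ t : ℝ, 1 ≤ t → |p.eval t| ≤ C * t ^ n) :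
    ∃ c : Fin (n+1) → ℝ, ∀ t, p.eval t = ∑ j : Fin (n+1), c j * t ^ (j : ℕ) := by
  refine ⟨fun j => p.coeff j, fun t => ?_⟩
  rw [Polynomial.eval_eq_sum_range' (Nat.lt_succ_of_le (natDegree_le_of_bound p n C h)),
    Finset.sum_range]

/-! ### Affine dependence on a segment summand -/

lemma additive_mono_linear (f : ℝ → ℝ) (hadd : ∀ s r, 0 ≤ s → 0 ≤ r → f (s + r) = f s + f r)
    (hpos : ∀ s, 0 ≤ s → 0 ≤ f s) (s : ℝ) (hs : 0 ≤ s) : f s = s * f 1 := by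
  have h0 : f 0 = 0 := by have := hadd 0 0 le_rfl le_rfl; simp at this; exact this
  have hmono : ∀ a b, 0 ≤ a → a ≤ b → f a ≤ f b := by
    intro a b ha hab
    have h1 := hadd a (b - a) ha (by linarith)
    have h2 := hpos (b - a) (by linarith)
    rw [add_sub_cancel] at h1
    linarith
  have hn : ∀ (m : ℕ) (a : ℝ), 0 ≤ a → f (m * a) = m * f a := by
    intro m a ha
    induction m with
    | zero => simp [h0]
    | succ m ih =>
      push_cast
      rw [add_mul, add_mul, one_mul, one_mul, hadd _ _ (by positivity) ha, ih]
  have hf1 := hpos 1 zero_le_one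
  have key : ∀ m : ℕ, m * |f s - s * f 1| ≤ f 1 := by
    intro m
    have h1 := Nat.floor_le (show 0 ≤ m * s by positivity)
    have h2 := (Nat.lt_floor_add_one (m * s : ℝ)).le
    have h3 := hmono _ _ (by positivity) h1
    have h4 := hmono _ _ (by positivity) h2
    have h5 := hn ⌊(m * s : ℝ)⌋₊ 1 zero_le_one
    have h6 := hadd ⌊(m * s : ℝ)⌋₊ 1 (by positivity) zero_le_one
    rw [mul_one] at h5
    rw [hn m s hs] at h3 h4
    have : (m : ℝ) * |f s - s * f 1| = |m * f s - m * s * f 1| := by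
      rw [← Nat.abs_cast (R := ℝ) m, ← abs_mul, Nat.abs_cast]; ring_nf
    rw [this, abs_le]
    constructor <;> nlinarith
  by_contra hne
  have hp : 0 < |f s - s * f 1| := abs_pos.2 (sub_ne_zero.2 hne)
  obtain ⟨m, hm⟩ := exists_nat_gt (f 1 / |f s - s * f 1|)
  rw [div_lt_iff₀ hp] at hm
  linarith [key m]

lemma mem_seg_smul {n : ℕ} {v x : En n} {s : ℝ} (hs : 0 ≤ s) :
    x ∈ s • segment ℝ (0 : En n) v ↔ ∃ a, 0 ≤ a ∧ a ≤ s ∧ x = a • v := by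
  rw [segment_eq_image']
  constructor
  · rintro ⟨_, ⟨θ, ⟨h0, h1⟩, rfl⟩, rfl⟩
    exact ⟨s * θ, by positivity, by nlinarith, by simp [smul_smul]⟩
  · rintro ⟨a, h0, h1, rfl⟩
    rcases hs.eq_or_lt with rfl | hs'
    · have : a = 0 := le_antisymm h1 h0
      subst this
      exact ⟨0, ⟨0, by simp, by simp⟩, by simp⟩
    · refine ⟨(a / s) • v, ⟨a / s, ⟨by positivity, (div_le_one hs').2 h1⟩, by simp⟩, ?_⟩
      simp [smul_smul, mul_div_cancel₀ _ hs'.ne']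

lemma isCompact_seg {n : ℕ} (v : En n) : IsCompact (segment ℝ (0 : En n) v) := by
  rw [segment_eq_image']
  exact isCompact_Icc.image (by fun_prop)

lemma vol_real_vadd {n : ℕ} (x : En n) (A : Set (En n)) :
    volume.real (x +ᵥ A) = volume.real A := by
  simp [measureReal_def, measure_vadd]

lemma seg_affine {n : ℕ} {A : Set (En n)} (hA : IsCompact A) (hc : Convex ℝ A) (v : En n)
    (s : ℝ) (hs : 0 ≤ s) :
    volume.real (A + s • segment ℝ 0 v) = volume.real A +
      s * (volume.real (A + segment ℝ 0 v) - volume.real A) := by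
  have hcomp : ∀ s : ℝ, IsCompact (A + s • segment ℝ (0 : En n) v) :=
    fun s => hA.add ((isCompact_seg v).smul s)
  have hmem : ∀ (s : ℝ) (x : En n), 0 ≤ s → (x ∈ A + s • segment ℝ (0 : En n) v ↔
      ∃ a, 0 ≤ a ∧ a ≤ s ∧ x - a • v ∈ A) := by
    intro s x hs
    constructor
    · rintro ⟨k, hk, y, hy, rfl⟩
      obtain ⟨a, h0, h1, rfl⟩ := (mem_seg_smul hs).1 hy
      exact ⟨a, h0, h1, by simpa using hk⟩
    · rintro ⟨a, h0, h1, h⟩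
      exact ⟨_, h, a • v, (mem_seg_smul hs).2 ⟨a, h0, h1, rfl⟩, by simp⟩
  have := additive_mono_linear
    (fun s => volume.real (A + s • segment ℝ (0 : En n) v) - volume.real A) ?_ ?_ s hs
  · simp only [one_smul] at this
    linarith
  · intro s r hs hr
    have hU : (A + s • segment ℝ (0 : En n) v) ∪ ((s • v) +ᵥ (A + r • segment ℝ (0 : En n) v))
        = A + (s + r) • segment ℝ (0 : En n) v := by
      ext x
      rw [mem_union, hmem s x hs, hmem (s+r) x (by linarith), mem_vadd_set_iff_neg_vadd_mem,
        hmem r _ hr]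
      constructor
      · rintro (⟨a, h0, h1, h⟩ | ⟨a, h0, h1, h⟩)
        · exact ⟨a, h0, by linarith, h⟩
        · refine ⟨s + a, by linarith, by linarith, ?_⟩
          convert h using 1
          simp only [vadd_eq_add]; module
      · rintro ⟨a, h0, h1, h⟩
        rcases le_total a s with h2 | h2
        · exact Or.inl ⟨a, h0, h2, h⟩
        · refine Or.inr ⟨a - s, by linarith, by linarith, ?_⟩
          convert h using 1
          simp only [vadd_eq_add]; module
    have hI : (A + s • segment ℝ (0 : En n) v) ∩ ((s • v) +ᵥ (A + r • segment ℝ (0 : En n) v))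
        = (s • v) +ᵥ A := by
      ext x
      rw [mem_inter_iff, hmem s x hs, mem_vadd_set_iff_neg_vadd_mem, hmem r _ hr,
        mem_vadd_set_iff_neg_vadd_mem]
      simp only [vadd_eq_add]
      constructor
      · rintro ⟨⟨a, h0, h1, h⟩, ⟨b, h2, h3, h4⟩⟩
        by_cases hz : (s - a) + b = 0
        · have : a = s := by linarith
          subst this
          convert h using 1; module
        · have hp : 0 < (s - a) + b := lt_of_le_of_ne (by linarith) (Ne.symm hz)
          have := hc h h4 (a := b / (s - a + b)) (b := (s - a) / (s - a + b)) (by positivity)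
            (div_nonneg (by linarith) hp.le) (by field_simp; ring)
          convert this using 1
          match_scalars <;> field_simp <;> ring
      · intro h
        refine ⟨⟨s, hs, le_rfl, ?_⟩, ⟨0, le_rfl, hr, ?_⟩⟩
        · convert h using 1; module
        · convert h using 1; module
    have := measureReal_union_add_inter (μ := (volume : Measure (En n)))
      (s := A + s • segment ℝ (0 : En n) v)
      (t := (s • v) +ᵥ (A + r • segment ℝ (0 : En n) v))
      ((hcomp r).vadd _).measurableSet (hcomp s).measure_lt_top.ne
      ((hcomp r).vadd _).measure_lt_top.ne
    rw [hU, hI, vol_real_vadd, vol_real_vadd] at this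
    linarith
  · intro s hs
    refine sub_nonneg.2 (measureReal_mono ?_ (hcomp s).measure_lt_top.ne)
    intro x hx
    exact (hmem s x hs).2 ⟨0, le_rfl, hs, by simpa using hx⟩

/-! ### Zonotopes -/

/-- The zonotope spanned by a list of vectors. -/
def zono {n : ℕ} : List (En n) → Set (En n)
  | [] => 0
  | v :: l => segment ℝ 0 v + zono l

/-- Its support function. -/
def zsup {n : ℕ} (l : List (En n)) (x : En n) : ℝ := (l.map fun v => max (inner ℝ x v) 0).sum

lemma zono_compact {n : ℕ} (l : List (En n)) : IsCompact (zono l) := by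
  induction l with
  | nil => exact isCompact_singleton
  | cons v l ih => exact (isCompact_seg v).add ih

lemma zono_convex {n : ℕ} (l : List (En n)) : Convex ℝ (zono l) := by
  induction l with
  | nil => exact convex_singleton 0
  | cons v l ih => exact (convex_segment 0 v).add ih

lemma zono_le {n : ℕ} (l : List (En n)) (x : En n) : ∀ z ∈ zono l, inner ℝ x z ≤ zsup l x := by
  induction l with
  | nil => rintro z rfl; simp [zsup]
  | cons v l ih =>
    rintro _ ⟨y, hy, z, hz, rfl⟩
    have hy' : y ∈ (1:ℝ) • segment ℝ (0 : En n) v := by rwa [one_smul]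
    obtain ⟨a, h0, h1, rfl⟩ := (mem_seg_smul zero_le_one).1 hy'
    have := ih z hz
    simp only [zsup, List.map_cons, List.sum_cons, inner_add_right, inner_smul_right] at this ⊢
    refine add_le_add ?_ this
    have h2 := le_max_left (inner ℝ x v) 0
    have h3 := le_max_right (inner ℝ x v) 0
    nlinarith

lemma zono_attain {n : ℕ} (l : List (En n)) (x : En n) : ∃ z ∈ zono l, inner ℝ x z = zsup l x := by
  induction l with
  | nil => exact ⟨0, rfl, by simp [zsup]⟩
  | cons v l ih =>
    obtain ⟨z, hz, h⟩ := ih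
    simp only [zsup, List.map_cons, List.sum_cons] at h ⊢
    rcases le_total (inner ℝ x v) 0 with h1 | h1
    · exact ⟨0 + z, ⟨0, left_mem_segment ℝ 0 v, z, hz, rfl⟩, by simp [h, max_eq_right h1]⟩
    · exact ⟨v + z, ⟨v, right_mem_segment ℝ 0 v, z, hz, rfl⟩, by
        simp [inner_add_right, h, max_eq_left h1]⟩

lemma zono_poly {n : ℕ} (l : List (En n)) : ∀ A : Set (En n), IsCompact A → Convex ℝ A →
    ∃ p : Polynomial ℝ, ∀ t : ℝ, 0 ≤ t → volume.real (A + t • zono l) = p.eval t := by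
  induction l with
  | nil =>
    intro A _ _
    refine ⟨Polynomial.C (volume.real A), fun t _ => ?_⟩
    simp [zono]
  | cons v l ih =>
    intro A hA hc
    obtain ⟨p, hp⟩ := ih A hA hc
    obtain ⟨q, hq⟩ := ih (A + segment ℝ 0 v) (hA.add (isCompact_seg v))
      (hc.add (convex_segment 0 v))
    refine ⟨p + Polynomial.X * (q - p), fun t ht => ?_⟩
    have h1 : A + t • zono (v :: l) = (A + t • zono l) + t • segment ℝ 0 v := by
      rw [zono, smul_add]; abel
    have h2 : (A + t • zono l) + segment ℝ 0 v = (A + segment ℝ 0 v) + t • zono l := by abel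
    rw [h1, seg_affine (hA.add ((zono_compact l).smul t)) (hc.add ((zono_convex l).smul t)) v t ht,
      h2, hp t ht, hq t ht]
    simp

lemma zono_sub_ball {n : ℕ} (l : List (En n)) (r : ℝ) (hr : 0 ≤ r)
    (h : ∀ x, zsup l x ≤ r * ‖x‖) : zono l ⊆ closedBall 0 r := by
  intro z hz
  rw [mem_closedBall_zero_iff]
  have h1 := (zono_le l z z hz).trans (h z)
  rw [real_inner_self_eq_norm_mul_norm] at h1
  rcases (norm_nonneg z).eq_or_lt with h0 | h0
  · rwa [← h0]
  · exact le_of_mul_le_mul_right h1 h0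

lemma ball_sub_zono {n : ℕ} (l : List (En n)) (r : ℝ)
    (h : ∀ x, r * ‖x‖ ≤ zsup l x) : closedBall 0 r ⊆ zono l := by
  intro y hy
  rw [mem_closedBall_zero_iff] at hy
  by_contra hn
  obtain ⟨f, u, h1, h2⟩ := geometric_hahn_banach_closed_point (zono_convex l)
    (zono_compact l).isClosed hn
  set x := (InnerProductSpace.toDual ℝ (En n)).symm f with hx
  have hf : ∀ z, f z = inner ℝ x z := fun z => by
    rw [hx, InnerProductSpace.toDual_symm_apply]
  obtain ⟨z, hz, hz2⟩ := zono_attain l x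
  have h3 := h1 z hz
  rw [hf, hz2] at h3
  rw [hf] at h2
  have h4 := real_inner_le_norm x y
  have h5 := h x
  have := mul_le_mul_of_nonneg_left hy (norm_nonneg x)
  nlinarith

lemma rot_inv {n : ℕ} (e x : En n) (he : ‖e‖ = 1) :
    ∫ u in closedBall (0 : En n) 1, max (inner ℝ x u) 0
      = (∫ u in closedBall (0 : En n) 1, max (inner ℝ e u) 0) * ‖x‖ := by
  set R := (ℝ ∙ (‖x‖ • e - x))ᗮ.reflection with hR
  have hRe : R (‖x‖ • e) = x := Submodule.reflection_sub (by simp [norm_smul, he])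
  have hmp : MeasurePreserving R volume volume := R.measurePreserving
  have hpre : R ⁻¹' (closedBall (0 : En n) 1) = closedBall 0 1 := by
    ext u; simp
  have := hmp.setIntegral_preimage_emb R.toHomeomorph.measurableEmbedding
    (fun u => max (inner ℝ x u) 0) (closedBall (0 : En n) 1)
  rw [← this, hpre, ← integral_mul_const]
  congr 1
  ext u
  have h1 : inner ℝ x (R u) = ‖x‖ * inner ℝ e u := by
    conv_lhs => rw [← hRe]
    rw [R.inner_map_map, real_inner_smul_left]
  rw [h1, max_mul_of_nonneg _ _ (norm_nonneg x), zero_mul, mul_comm]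

lemma ball_int_pos {n : ℕ} (e : En n) (he : ‖e‖ = 1) :
    0 < ∫ u in closedBall (0 : En n) 1, max (inner ℝ e u) 0 := by
  have hcont : Continuous fun u : En n => max (inner ℝ e u) 0 := by fun_prop
  have hnn : 0 ≤ᵐ[volume.restrict (closedBall (0 : En n) 1)] fun u : En n => max (inner ℝ e u) 0 :=
    Filter.Eventually.of_forall fun u => le_max_right _ _
  rw [setIntegral_pos_iff_support_of_nonneg_ae hnn
    (hcont.continuousOn.integrableOn_compact (isCompact_closedBall _ _))]
  have hop : IsOpen ({u : En n | 0 < inner ℝ e u} ∩ ball 0 1) :=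
    (isOpen_lt continuous_const (by fun_prop)).inter isOpen_ball
  refine lt_of_lt_of_le (hop.measure_pos volume ⟨(1/2 : ℝ) • e, ?_, ?_⟩) (measure_mono ?_)
  · simp [inner_smul_right, he]
  · simp [norm_smul, he]; norm_num
  · rintro u ⟨h1, h2⟩
    refine ⟨?_, ball_subset_closedBall h2⟩
    simp only [Function.mem_support]
    exact (lt_max_of_lt_left h1).ne'

lemma zono_approx {n : ℕ} (hn : 1 ≤ n) (ε : ℝ) (hε : 0 < ε) :
    ∃ l : List (En n), ∀ x, (1 - ε) * ‖x‖ ≤ zsup l x ∧ zsup l x ≤ (1 + ε) * ‖x‖ := by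
  classical
  set e : En n := EuclideanSpace.single ⟨0, hn⟩ 1 with hedef
  have he : ‖e‖ = 1 := by simp [hedef]
  set c := ∫ u in closedBall (0 : En n) 1, max (inner ℝ e u) 0 with hc
  have hc0 : 0 < c := ball_int_pos e he
  set ν := (volume : Measure (En n)).restrict (closedBall 0 1) with hν
  have hfin : IsFiniteMeasure ν := ⟨by
    rw [hν, Measure.restrict_apply_univ]; exact (isCompact_closedBall _ _).measure_lt_top⟩
  have hid : Integrable (fun u : En n => u) ν :=
    continuous_id.continuousOn.integrableOn_compact (isCompact_closedBall _ _)
  obtain ⟨g, hg, hgm⟩ := (memLp_one_iff_integrable.2 hid).exists_simpleFunc_eLpNorm_sub_lt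
    (by simp) (ε := ENNReal.ofReal (ε * c)) (by simp; positivity)
  have hgi : Integrable g ν := memLp_one_iff_integrable.1 hgm
  have hdiff : ∫ u, ‖u - g u‖ ∂ν ≤ ε * c := by
    rw [eLpNorm_one_eq_lintegral_enorm] at hg
    refine (integral_norm_eq_lintegral_enorm (hid.sub hgi).aestronglyMeasurable).le.trans ?_
    exact ENNReal.toReal_le_of_le_ofReal (by positivity) hg.le
  refine ⟨g.range.toList.map fun y => (c⁻¹ * ν.real (g ⁻¹' {y})) • y, fun x => ?_⟩
  have hz : zsup (g.range.toList.map fun y => (c⁻¹ * ν.real (g ⁻¹' {y})) • y) x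
      = c⁻¹ * ∫ u, max (inner ℝ x (g u)) 0 ∂ν := by
    have h1 : ∫ u, max (inner ℝ x (g u)) 0 ∂ν = (g.map fun y => max (inner ℝ x y) 0).integral ν := by
      rw [SimpleFunc.integral_eq_integral]
      · rfl
      · exact SimpleFunc.integrable_of_isFiniteMeasure _
    rw [h1, SimpleFunc.map_integral _ _ hgi (by simp), zsup, List.map_map, Finset.sum_map_toList,
      Finset.mul_sum]
    refine Finset.sum_congr rfl fun y _ => ?_
    have : 0 ≤ c⁻¹ * ν.real (g ⁻¹' {y}) := by positivity
    simp only [Function.comp, inner_smul_right, smul_eq_mul]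
    rw [← mul_assoc, mul_max_of_nonneg _ _ this, mul_zero]
  have i1 : Integrable (fun u => max (inner ℝ x (g u)) 0) ν :=
    SimpleFunc.integrable_of_isFiniteMeasure (g.map fun y => max (inner ℝ x y) 0)
  have i2 : Integrable (fun u => max (inner ℝ x u) 0) ν :=
    (show Continuous fun u : En n => max (inner ℝ x u) 0 by fun_prop).continuousOn.integrableOn_compact
      (isCompact_closedBall _ _)
  have hest : |c * ‖x‖ - ∫ u, max (inner ℝ x (g u)) 0 ∂ν| ≤ ε * c * ‖x‖ := by
    rw [hc, ← rot_inv e x he, ← integral_sub i2 i1]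
    refine (abs_integral_le_integral_abs).trans ?_
    calc ∫ u, |max (inner ℝ x u) 0 - max (inner ℝ x (g u)) 0| ∂ν
        ≤ ∫ u, ‖u - g u‖ * ‖x‖ ∂ν := by
          refine integral_mono (i2.sub i1).abs ((hid.sub hgi).norm.mul_const _) fun u => ?_
          refine (abs_max_sub_max_le_abs _ _ _).trans ?_
          rw [← inner_sub_right, mul_comm]
          exact abs_real_inner_le_norm _ _
      _ ≤ ε * c * ‖x‖ := by
          rw [integral_mul_const]
          exact mul_le_mul_of_nonneg_right hdiff (norm_nonneg x)
  rw [hz]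
  rw [abs_le] at hest
  rw [inv_mul_eq_div, le_div_iff₀ hc0, div_le_iff₀ hc0]
  constructor <;> nlinarith

/-! ### The Steiner formula -/

lemma vol_real_smul {n : ℕ} (r : ℝ) (hr : 0 ≤ r) (A : Set (En n)) :
    volume.real (r • A) = r ^ n * volume.real A := by
  rw [measureReal_def, Measure.addHaar_smul_of_nonneg _ hr, ENNReal.toReal_mul,
    ENNReal.toReal_ofReal (by positivity), measureReal_def]
  simp

lemma smul_mem_of_zero {n : ℕ} {A : Set (En n)} (hc : Convex ℝ A) (h0 : (0 : En n) ∈ A) {r : ℝ}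
    (hr : 0 ≤ r) (hr1 : r ≤ 1) : r • A ⊆ A := by
  rintro _ ⟨x, hx, rfl⟩
  exact hc.smul_mem_of_zero_mem h0 hx ⟨hr, hr1⟩

lemma sub_smul_of_zero {n : ℕ} {A : Set (En n)} (hc : Convex ℝ A) (h0 : (0 : En n) ∈ A) {r : ℝ}
    (hr1 : 1 ≤ r) : A ⊆ r • A := fun _ hx => hc.mem_smul_of_zero_mem h0 hx hr1

lemma closedBall_eq_smul {n : ℕ} (r : ℝ) (hr : 0 ≤ r) :
    closedBall (0 : En n) r = r • closedBall (0 : En n) 1 := by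
  rw [_root_.smul_closedBall _ _ zero_le_one]; simp [abs_of_nonneg hr]

lemma zono_steiner {n : ℕ} {A : Set (En n)} (hA : IsCompact A) (hc : Convex ℝ A)
    (h0 : (0 : En n) ∈ A) (l : List (En n)) :
    ∃ c : Fin (n+1) → ℝ, ∀ t : ℝ, 0 ≤ t →
      volume.real (A + t • zono l) = ∑ j : Fin (n+1), c j * t ^ (j : ℕ) := by
  obtain ⟨p, hp⟩ := zono_poly l A hA hc
  obtain ⟨c, hcc⟩ := poly_coeffs p n (volume.real (A + zono l)) (fun t ht => by
    have ht0 : 0 ≤ t := by linarith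
    rw [← hp t ht0, abs_of_nonneg measureReal_nonneg, mul_comm, ← vol_real_smul t ht0, smul_add]
    exact measureReal_mono (add_subset_add_right (sub_smul_of_zero hc h0 ht))
      ((hA.smul t).add ((zono_compact l).smul t)).measure_lt_top.ne)
  exact ⟨c, fun t ht => by rw [hp t ht, hcc]⟩

lemma steiner_zero {n : ℕ} (hn : 1 ≤ n) {A : Set (En n)} (hA : IsCompact A) (hc : Convex ℝ A)
    (h0 : (0 : En n) ∈ A) :
    ∃ c : Fin (n+1) → ℝ, ∀ t : ℝ, 0 ≤ t →
      volume.real (A + t • closedBall (0 : En n) 1) = ∑ j : Fin (n+1), c j * t ^ (j : ℕ) := by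
  have hε0 : ∀ m : ℕ, 0 < 1 / ((m : ℝ) + 1) := fun m => by positivity
  have hε1 : ∀ m : ℕ, 1 / ((m : ℝ) + 1) ≤ 1 := fun m => by
    rw [div_le_one (by positivity)]; linarith [Nat.cast_nonneg (α := ℝ) m]
  choose l hl using fun m : ℕ => zono_approx (n := n) hn (1 / ((m : ℝ) + 1)) (hε0 m)
  choose c hcc using fun m : ℕ => zono_steiner hA hc h0 (l m)
  refine poly_limit n c _ fun t ht => ?_
  have hB : IsCompact (closedBall (0 : En n) 1) := isCompact_closedBall _ _
  set g := volume.real (A + t • closedBall (0 : En n) 1) with hg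
  have hlo : ∀ m : ℕ, (1 - 1 / ((m : ℝ) + 1)) ^ n * g ≤ ∑ j : Fin (n+1), c m j * t ^ (j : ℕ) := by
    intro m
    have hr : 0 ≤ 1 - 1 / ((m : ℝ) + 1) := by linarith [hε1 m]
    rw [← hcc m t ht, hg, ← vol_real_smul _ hr, smul_add, smul_comm, ← closedBall_eq_smul _ hr]
    refine measureReal_mono (add_subset_add (smul_mem_of_zero hc h0 hr (by linarith [hε0 m]))
      (smul_set_mono (ball_sub_zono _ _ fun x => (hl m x).1)))
      (hA.add ((zono_compact (l m)).smul t)).measure_lt_top.ne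
  have hhi : ∀ m : ℕ, ∑ j : Fin (n+1), c m j * t ^ (j : ℕ) ≤ (1 + 1 / ((m : ℝ) + 1)) ^ n * g := by
    intro m
    have hr : 0 ≤ 1 + 1 / ((m : ℝ) + 1) := by linarith [hε0 m]
    rw [← hcc m t ht, hg, ← vol_real_smul _ hr, smul_add, smul_comm _ t, ← closedBall_eq_smul _ hr]
    refine measureReal_mono (add_subset_add (sub_smul_of_zero hc h0 (by linarith [hε0 m]))
      (smul_set_mono (zono_sub_ball _ _ hr fun x => (hl m x).2)))
      ((hA.smul _).add ((isCompact_closedBall _ _).smul t)).measure_lt_top.ne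
  have hlim := tendsto_one_div_add_atTop_nhds_zero_nat (𝕜 := ℝ)
  refine tendsto_of_tendsto_of_tendsto_of_le_of_le ?_ ?_ hlo hhi
  · simpa using ((hlim.const_sub 1).pow n).mul_const g
  · simpa using ((hlim.const_add 1).pow n).mul_const g

/-- The parallel volume. -/
def pvol {n : ℕ} (A : Set (En n)) (t : ℝ) : ℝ := volume.real (A + t • closedBall (0 : En n) 1)

lemma set_vadd_add {n : ℕ} (x : En n) (A B : Set (En n)) : (x +ᵥ A) + B = x +ᵥ (A + B) := by
  rw [← singleton_vadd, ← singleton_vadd, vadd_eq_add, vadd_eq_add, add_assoc]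

lemma pvol_vadd {n : ℕ} (x : En n) (A : Set (En n)) (t : ℝ) : pvol (x +ᵥ A) t = pvol A t := by
  rw [pvol, set_vadd_add, vol_real_vadd, pvol]

lemma steiner {n : ℕ} (hn : 1 ≤ n) (K : ConvexBody (En n)) :
    ∃ c : Fin (n+1) → ℝ, ∀ t : ℝ, 0 ≤ t →
      pvol (K : Set (En n)) t = ∑ j : Fin (n+1), c j * t ^ (j : ℕ) := by
  obtain ⟨a, ha⟩ := K.nonempty
  obtain ⟨c, h⟩ := steiner_zero hn (A := -a +ᵥ (K : Set (En n))) (K.isCompact.vadd _)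
    (K.convex.vadd _) ⟨a, ha, by simp⟩
  exact ⟨c, fun t ht => by rw [← h t ht, ← pvol_vadd (-a), pvol]⟩

lemma ballVol_pos (k : ℕ) : 0 < ballVol k :=
  ENNReal.toReal_pos (measure_closedBall_pos _ _ one_pos).ne'
    (isCompact_closedBall _ _).measure_lt_top.ne

lemma pvol_union {n : ℕ} {K L M N : ConvexBody (En n)}
    (hM : (M : Set (En n)) = (K : Set (En n)) ∪ (L : Set (En n)))
    (hN : (N : Set (En n)) = (K : Set (En n)) ∩ (L : Set (En n))) (t : ℝ) :
    pvol (M : Set (En n)) t + pvol (N : Set (En n)) t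
      = pvol (K : Set (En n)) t + pvol (L : Set (En n)) t := by
  have hB : IsCompact (t • closedBall (0 : En n) 1) := (isCompact_closedBall _ _).smul t
  have hBc : Convex ℝ (t • closedBall (0 : En n) 1) := (convex_closedBall _ _).smul t
  have hI : ((K : Set (En n)) ∩ (L : Set (En n))) + t • closedBall (0 : En n) 1
      = ((K : Set (En n)) + t • closedBall (0 : En n) 1) ∩ (L + t • closedBall (0 : En n) 1) := by
    refine Subset.antisymm inter_add_subset ?_
    rintro x ⟨⟨k, hk, b, hb, hkb⟩, ⟨l, hl, d, hd, hld⟩⟩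
    simp only at hkb hld
    have hseg : segment ℝ k l ⊆ (K : Set (En n)) ∪ L := by
      rw [← hM]
      exact M.convex.segment_subset (hM ▸ Or.inl hk) (hM ▸ Or.inr hl)
    obtain ⟨z, hz, hzK, hzL⟩ := isPreconnected_closed_iff.1
      (convex_segment k l).isPreconnected _ _ K.isClosed L.isClosed hseg
      ⟨k, left_mem_segment ℝ k l, hk⟩ ⟨l, right_mem_segment ℝ k l, hl⟩
    refine ⟨z, ⟨hzK, hzL⟩, x - z, ?_, by simp⟩
    obtain ⟨α, β, hα, hβ, hαβ, rfl⟩ := hz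
    have : x - (α • k + β • l) = α • b + β • d := by
      have h1 : b = x - k := by rw [← hkb]; simp
      have h2 : d = x - l := by rw [← hld]; simp
      rw [h1, h2]
      have : x = (α + β) • x := by rw [hαβ, one_smul]
      conv_lhs => rw [this]
      module
    rw [this]
    exact hBc hb hd hα hβ hαβ
  unfold pvol
  rw [hM, hN, union_add, hI]
  exact measureReal_union_add_inter (L.isCompact.add hB).measurableSet
    (K.isCompact.add hB).measure_lt_top.ne (L.isCompact.add hB).measure_lt_top.ne

lemma pvol_isometry {n : ℕ} (R : En n ≃ₗᵢ[ℝ] En n) (A : Set (En n)) (t : ℝ) :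
    pvol (R '' A) t = pvol A t := by
  have h1 : R '' A + t • closedBall (0 : En n) 1 = R '' (A + t • closedBall (0 : En n) 1) := by
    rw [image_add, image_smul_set]
    simp
  rw [pvol, h1, pvol, measureReal_def, measureReal_def]
  congr 1
  have hmp : MeasurePreserving R.symm volume volume := R.symm.measurePreserving
  have := hmp.measure_preimage_emb R.symm.toHomeomorph.measurableEmbedding
    (A + t • closedBall (0 : En n) 1)
  rw [← this]
  congr 1
  ext y
  simp only [mem_image, mem_preimage]
  constructor
  · rintro ⟨x, hx, rfl⟩; simpa using hx
  · intro h; exact ⟨_, h, by simp⟩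

lemma pvol_smul {n : ℕ} (A : Set (En n)) (s t : ℝ) (hs : 0 ≤ s) :
    pvol (s • A) (s * t) = s ^ n * pvol A t := by
  rw [pvol, mul_smul, ← smul_add, vol_real_smul _ hs, pvol]

lemma pvol_compare {n : ℕ} {K L : ConvexBody (En n)} {δ t : ℝ} (ht : 0 ≤ t)
    (h : dist K L < δ) : pvol (K : Set (En n)) t ≤ pvol (L : Set (En n)) (t + δ) := by
  have hδ : 0 ≤ δ := dist_nonneg.trans h.le
  refine measureReal_mono ?_
    (L.isCompact.add ((isCompact_closedBall _ _).smul (t + δ))).measure_lt_top.ne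
  rintro _ ⟨k, hk, b, hb, rfl⟩
  obtain ⟨l, hl, hkl⟩ := exists_dist_lt_of_hausdorffDist_lt hk h ConvexBody.hausdorffEDist_ne_top
  rw [← closedBall_eq_smul _ ht, mem_closedBall_zero_iff] at hb
  refine ⟨l, hl, k - l + b, ?_, by simp only; abel⟩
  rw [← closedBall_eq_smul _ (by linarith), mem_closedBall_zero_iff]
  rw [dist_eq_norm] at hkl
  linarith [norm_add_le (k - l) b]

lemma pvol_continuous {n : ℕ} (hn : 1 ≤ n) (t : ℝ) (ht : 0 < t) :
    Continuous fun K : ConvexBody (En n) => pvol (K : Set (En n)) t := by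
  rw [continuous_iff_continuousAt]
  intro K
  obtain ⟨c, hc⟩ := steiner hn K
  rw [Metric.continuousAt_iff]
  intro ε hε
  have hcont : Continuous fun t : ℝ => ∑ j : Fin (n+1), c j * t ^ (j : ℕ) := by fun_prop
  obtain ⟨η, hη, h⟩ := Metric.continuousAt_iff.1 (hcont.continuousAt (x := t)) ε hε
  set δ := min (η / 2) t with hδ
  have hδ0 : 0 < δ := lt_min (by positivity) ht
  have hδ1 : δ ≤ η / 2 := min_le_left _ _
  have hδ2 : δ ≤ t := min_le_right _ _
  refine ⟨δ, hδ0, fun {L} hL => ?_⟩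
  have h1 := pvol_compare ht.le hL
  have h2 := pvol_compare (K := K) (L := L) (t := t - δ) (δ := δ) (by linarith)
    (by rwa [dist_comm])
  rw [sub_add_cancel] at h2
  have h3 := h (x := t + δ) (by simp [abs_of_pos hδ0]; linarith)
  have h4 := h (x := t - δ) (by simp [abs_of_pos hδ0]; linarith)
  rw [← hc _ ht.le, Real.dist_eq, abs_lt] at h3 h4
  rw [← hc _ (by linarith)] at h3 h4
  rw [Real.dist_eq, abs_lt]
  constructor <;> linarith

/-- The isometry given by an element of `SO n`. -/
lemma soAct_isometry {n : ℕ} (g : SO n) : ∃ R : En n ≃ₗᵢ[ℝ] En n, ∀ x, R x = soAct g x := by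
  have hnorm : ∀ x, ‖soAct g x‖ = ‖x‖ := by
    intro x
    have hu : star ((g : Matrix.unitaryGroup (Fin n) ℝ) : Matrix (Fin n) (Fin n) ℝ) *
        ((g : Matrix.unitaryGroup (Fin n) ℝ) : Matrix (Fin n) (Fin n) ℝ) = 1 :=
      Matrix.UnitaryGroup.star_mul_self _
    have hin : inner ℝ (soAct g x) (soAct g x) = inner ℝ x x := by
      rw [← LinearMap.adjoint_inner_left, soAct, ← Matrix.toEuclideanLin_conjTranspose_eq_adjoint]
      congr 1
      ext i
      rw [Matrix.star_eq_conjTranspose] at hu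
      simp only [Matrix.toLpLin_apply, Matrix.mulVec_mulVec, hu, Matrix.one_mulVec]
    rw [real_inner_self_eq_norm_sq, real_inner_self_eq_norm_sq] at hin
    exact (sq_eq_sq₀ (norm_nonneg _) (norm_nonneg _)).1 hin
  exact ⟨LinearIsometry.toLinearIsometryEquiv ⟨soAct g, hnorm⟩ rfl, fun x => rfl⟩

lemma steinerFamily_iff {n : ℕ} (μ : Fin (n+1) → ConvexBody (En n) → ℝ) :
    SteinerFamily n μ ↔ ∀ (K : ConvexBody (En n)) (t : ℝ), 0 ≤ t →
      pvol (K : Set (En n)) t = ∑ k : Fin (n+1), (μ k.rev K * ballVol (k : ℕ)) * t ^ (k : ℕ) :=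
  Iff.rfl

/-- Two bodies with the same parallel volumes have the same intrinsic volumes. -/
lemma mu_congr {n : ℕ} {μ : Fin (n+1) → ConvexBody (En n) → ℝ} (hμ : SteinerFamily n μ)
    {K L : ConvexBody (En n)} (h : ∀ t, pvol (L : Set (En n)) t = pvol (K : Set (En n)) t)
    (k : Fin (n+1)) : μ k L = μ k K := by
  rw [steinerFamily_iff] at hμ
  have := congrFun (coeff_unique n (fun k => μ k.rev L * ballVol (k : ℕ))
    (fun k => μ k.rev K * ballVol (k : ℕ))
    fun t ht => by rw [← hμ L t ht.le, ← hμ K t ht.le, h]) k.rev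
  simpa [(ballVol_pos _).ne'] using this

lemma mu_valuation {n : ℕ} {μ : Fin (n+1) → ConvexBody (En n) → ℝ} (hμ : SteinerFamily n μ)
    (k : Fin (n+1)) : IsValuation (μ k) := by
  intro K L M N hM hN
  rw [steinerFamily_iff] at hμ
  have := congrFun (coeff_unique n (fun k => (μ k.rev M + μ k.rev N) * ballVol (k : ℕ))
    (fun k => (μ k.rev K + μ k.rev L) * ballVol (k : ℕ))
    fun t ht => by
      simp only [add_mul, Finset.sum_add_distrib]
      rw [← hμ M t ht.le, ← hμ N t ht.le, ← hμ K t ht.le, ← hμ L t ht.le, pvol_union hM hN]) k.rev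
  have h2 := mul_right_cancel₀ (ballVol_pos _).ne' this
  simpa using h2

lemma mu_continuous {n : ℕ} (hn : 1 ≤ n) {μ : Fin (n+1) → ConvexBody (En n) → ℝ}
    (hμ : SteinerFamily n μ) (k : Fin (n+1)) : Continuous (μ k) := by
  rw [steinerFamily_iff] at hμ
  have h : ∀ K, μ k K = (∑ i : Fin (n+1), (vdm n)⁻¹ k.rev i *
      pvol (K : Set (En n)) (((i : ℕ) : ℝ) + 1)) / ballVol (k.rev : ℕ) := by
    intro K
    rw [eq_div_iff (ballVol_pos _).ne']
    have := coeff_extract n (fun k => μ k.rev K * ballVol (k : ℕ)) k.rev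
    simp only [Fin.rev_rev] at this
    rw [this]
    refine Finset.sum_congr rfl fun i _ => ?_
    rw [hμ K _ (by positivity)]
  rw [show μ k = _ from funext h]
  refine Continuous.div_const ?_ _
  exact continuous_finsetSum _ fun i _ =>
    continuous_const.mul (pvol_continuous hn _ (by positivity))

lemma mu_homog_pos {n : ℕ} {μ : Fin (n+1) → ConvexBody (En n) → ℝ} (hμ : SteinerFamily n μ)
    (k : Fin (n+1)) (s : ℝ) (hs : 0 < s) (K L : ConvexBody (En n))
    (hL : (L : Set (En n)) = s • (K : Set (En n))) : μ k L = s ^ (k : ℕ) * μ k K := by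
  rw [steinerFamily_iff] at hμ
  have := congrFun (coeff_unique n (fun k => μ k.rev L * ballVol (k : ℕ) * s ^ (k : ℕ))
    (fun k => s ^ n * (μ k.rev K * ballVol (k : ℕ)))
    fun t ht => by
      have h1 := hμ L (s * t) (by positivity)
      rw [hL, pvol_smul _ _ _ hs.le, hμ K t ht.le] at h1
      simp only [mul_assoc, ← mul_pow, ← Finset.mul_sum] at h1 ⊢
      exact h1.symm) k.rev
  simp only [Fin.rev_rev] at this
  have hn : s ^ n = s ^ (k : ℕ) * s ^ (k.rev : ℕ) := by
    rw [← pow_add]; congr 1; rw [Fin.val_rev]; omega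
  have h1 : 0 < ballVol (k.rev : ℕ) * s ^ (k.rev : ℕ) := mul_pos (ballVol_pos _) (by positivity)
  refine mul_right_cancel₀ h1.ne' ?_
  rw [hn] at this
  linarith

lemma mu_homog {n : ℕ} (hn : 1 ≤ n) {μ : Fin (n+1) → ConvexBody (En n) → ℝ}
    (hμ : SteinerFamily n μ) (k : Fin (n+1)) : IsHomogeneousVal (k : ℕ) (μ k) := by
  intro s hs K L hL
  rcases hs.eq_or_lt with rfl | hs
  swap
  · exact mu_homog_pos hμ k s hs K L hL
  have hL' : L = (0 : ℝ) • K := ConvexBody.ext (by rw [hL, ConvexBody.coe_smul])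
  obtain ⟨C, hC0, hC⟩ := K.isBounded.exists_pos_norm_le
  have hlim : Filter.Tendsto (fun s : ℝ => s • K) (nhdsWithin 0 (Ioi 0)) (nhds L) := by
    rw [hL', tendsto_iff_dist_tendsto_zero]
    have hz : Filter.Tendsto (fun s : ℝ => s * C) (nhdsWithin 0 (Ioi 0)) (nhds 0) := by
      have : Continuous fun s : ℝ => s * C := by fun_prop
      simpa using (this.tendsto 0).mono_left nhdsWithin_le_nhds
    refine squeeze_zero' (Filter.Eventually.of_forall fun _ => dist_nonneg) ?_ hz
    filter_upwards [self_mem_nhdsWithin] with s hs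
    have hs : 0 < s := hs
    rw [← ConvexBody.hausdorffDist_coe]
    have hd : ∀ x ∈ (K : Set (En n)), dist (s • x) ((0:ℝ) • x) ≤ s * C := fun x hx => by
      simp only [zero_smul, dist_zero_right, norm_smul, Real.norm_eq_abs, abs_of_pos hs]
      exact mul_le_mul_of_nonneg_left (hC x hx) hs.le
    refine hausdorffDist_le_of_mem_dist (by positivity) ?_ ?_
    · rw [ConvexBody.coe_smul, ConvexBody.coe_smul]
      rintro _ ⟨x, hx, rfl⟩
      exact ⟨(0:ℝ) • x, ⟨x, hx, rfl⟩, hd x hx⟩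
    · rw [ConvexBody.coe_smul, ConvexBody.coe_smul]
      rintro _ ⟨x, hx, rfl⟩
      exact ⟨s • x, ⟨x, hx, rfl⟩, by rw [dist_comm]; exact hd x hx⟩
  have h1 := ((mu_continuous hn hμ k).tendsto L).comp hlim
  have h2 : Filter.Tendsto (fun s : ℝ => s ^ (k : ℕ) * μ k K) (nhdsWithin 0 (Ioi 0))
      (nhds ((0:ℝ) ^ (k : ℕ) * μ k K)) :=
    ((show Continuous fun s : ℝ => s ^ (k : ℕ) * μ k K by fun_prop).tendsto 0).mono_left
      nhdsWithin_le_nhds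
  refine tendsto_nhds_unique (h1.congr' ?_) h2
  filter_upwards [self_mem_nhdsWithin] with s hs
  exact mu_homog_pos hμ k s hs K _ (ConvexBody.coe_smul s K)

/-- existence and uniqueness of the intrinsic volumes via the Steiner formula,
together with their properties: each `μ_k` is a continuous, translation invariant,
`SO(n)`-invariant valuation, homogeneous of degree `k`, and even. -/
theorem statement0 (n : ℕ) (hn : 1 ≤ n) :
    (∃! μ : Fin (n+1) → ConvexBody (En n) → ℝ, SteinerFamily n μ) ∧
    (∀ μ : Fin (n+1) → ConvexBody (En n) → ℝ, SteinerFamily n μ →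
      ∀ k : Fin (n+1), IsValuation (μ k) ∧ Continuous (μ k) ∧
        IsTranslationInvariant (μ k) ∧ IsSOInvariant n (μ k) ∧
        IsHomogeneousVal (k : ℕ) (μ k) ∧ IsEvenVal (μ k)) := by
  refine ⟨?_, fun μ hμ k => ⟨mu_valuation hμ k, mu_continuous hn hμ k, ?_, ?_, mu_homog hn hμ k, ?_⟩⟩
  · choose c hc using fun K : ConvexBody (En n) => steiner hn K
    refine ⟨fun k K => c K k.rev / ballVol (k.rev : ℕ), ?_, ?_⟩
    · change SteinerFamily n _
      rw [steinerFamily_iff]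
      intro K t ht
      rw [hc K t ht]
      refine Finset.sum_congr rfl fun k _ => ?_
      simp only [Fin.rev_rev]
      rw [div_mul_cancel₀ _ (ballVol_pos _).ne']
    · intro ν hν
      rw [steinerFamily_iff] at hν
      ext k K
      rw [eq_div_iff (ballVol_pos _).ne']
      have := congrFun (coeff_unique n (fun k => ν k.rev K * ballVol (k : ℕ)) (c K)
        fun t ht => by rw [← hν K t ht.le, hc K t ht.le]) k.rev
      simpa using this
  · intro x K L hL
    exact mu_congr hμ (fun t => by rw [hL, pvol_vadd]) k
  · intro g K L hL
    obtain ⟨R, hR⟩ := soAct_isometry g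
    have hL2 : (L : Set (En n)) = R '' (K : Set (En n)) := by
      rw [hL]; exact image_congr fun x _ => (hR x).symm
    exact mu_congr hμ (fun t => by rw [hL2, pvol_isometry]) k
  · intro K L hL
    have hL2 : (L : Set (En n)) = LinearIsometryEquiv.neg ℝ '' (K : Set (En n)) := by
      rw [hL]; ext x; simp
    exact mu_congr hμ (fun t => by rw [hL2, pvol_isometry]) k

end
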